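/- Let T be a preorder, ι an index set, B ⊆ A ⊆ ι with A finite, and (Ω, m, μ) a probability space. Let S : ι → T → Ω → ℝ be a family of processes, each S i t strongly measurable, and suppose the A-vector process S^A : T → Ω → (A → ℝ), S^A t ω = (fun i : A => S i t ω), is a martingale with respect to some filtration ℋ of m and μ. Then the B-vector process S^B t ω = (fun i : B => S i t ω) is a martingale with respect to the natural filtration of S^A and μ. (Paper's Proposition 3.3, stability under restriction: if a group of assets is priced as a martingale under an admissible filtration, every subgroup is a martingale under the canonical filtration generated by the full group.) -/

import Mathlib

open MeasureTheory

namespace MeasureTheory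

/-- The image of a martingale under a continuous linear map is a martingale. -/
theorem Martingale.continuousLinearMap_comp {Ω T E F : Type*} [Preorder T]
    {m : MeasurableSpace Ω} {μ : Measure Ω}
    [NormedAddCommGroup E] [NormedSpace ℝ E] [CompleteSpace E]
    [NormedAddCommGroup F] [NormedSpace ℝ F] [CompleteSpace F]
    {f : T → Ω → E} {𝒢 : Filtration T m} (hf : Martingale f 𝒢 μ) (L : E →L[ℝ] F) :
    Martingale (fun t ω => L (f t ω)) 𝒢 μ := by
  refine ⟨fun t => L.continuous.comp_stronglyMeasurable (hf.stronglyMeasurable t),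
    fun s t hst => ?_⟩
  filter_upwards [L.comp_condExp_comm (m := 𝒢 s) (hf.integrable t), hf.condExp_ae_eq hst]
    with ω hω hω'
  rw [← hω', ← Function.comp_apply (f := L), hω]
  rfl

/-- A martingale is a martingale for every smaller filtration to which it is adapted. -/
theorem Martingale.of_filtration_le {Ω T E : Type*} [Preorder T]
    {m : MeasurableSpace Ω} {μ : Measure Ω} [IsFiniteMeasure μ]
    [NormedAddCommGroup E] [NormedSpace ℝ E] [CompleteSpace E]
    {f : T → Ω → E} {𝒢 ℋ : Filtration T m} (hf : Martingale f ℋ μ)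
    (hle : 𝒢 ≤ ℋ) (hadp : StronglyAdapted 𝒢 f) : Martingale f 𝒢 μ := by
  refine ⟨hadp, fun s t hst => ?_⟩
  calc μ[f t | 𝒢 s] =ᵐ[μ] μ[μ[f t | ℋ s] | 𝒢 s] :=
        (condExp_condExp_of_le (hle s) (ℋ.le s)).symm
    _ =ᵐ[μ] μ[f s | 𝒢 s] := condExp_congr_ae (hf.condExp_ae_eq hst)
    _ = f s := condExp_of_stronglyMeasurable (𝒢.le s) (hadp s) (hf.integrable s)

/-- The natural filtration is the smallest filtration to which a process is adapted. -/
theorem Filtration.natural_le {Ω T E : Type*} [Preorder T] {m : MeasurableSpace Ω}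
    [TopologicalSpace E] [TopologicalSpace.MetrizableSpace E] [MeasurableSpace E] [BorelSpace E]
    {u : T → Ω → E} (hu : ∀ t, StronglyMeasurable (u t)) {ℋ : Filtration T m}
    (hadp : StronglyAdapted ℋ u) : Filtration.natural u hu ≤ ℋ := fun _ =>
  iSup₂_le fun s hst => ((hadp s).mono (ℋ.mono hst)).measurable.comap_le

end MeasureTheory

/-- **Stability under restriction (Proposition 3.3).**
If the `A`-vector price process is a martingale under some filtration `ℋ`, then for any
subgroup `B ⊆ A` the `B`-vector process is a martingale under the natural filtration
generated by the `A`-vector process. -/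
theorem martingale_restriction_natural
    {Ω ι T : Type*} [Preorder T]
    {m : MeasurableSpace Ω} {μ : Measure Ω} [IsProbabilityMeasure μ]
    (S : ι → T → Ω → ℝ) (A B : Finset ι) (hBA : B ⊆ A)
    (hSm : ∀ i t, StronglyMeasurable (S i t))
    (ℋ : Filtration T m)
    (hSA : Martingale (fun t ω (i : A) => S i t ω) ℋ μ) :
    Martingale (fun t ω (i : B) => S i t ω)
      (Filtration.natural (fun t ω (i : A) => S i t ω)
        (fun t => (measurable_pi_lambda _ fun i : A => (hSm i t).measurable).stronglyMeasurable)) μ := by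
  have hnat := hSA.of_filtration_le (Filtration.natural_le
    (fun t => (measurable_pi_lambda _ fun i : A => (hSm i t).measurable).stronglyMeasurable)
    hSA.stronglyAdapted) (Filtration.stronglyAdapted_natural _)
  exact hnat.continuousLinearMap_comp
    (ContinuousLinearMap.pi fun i : B => ContinuousLinearMap.proj (⟨i, hBA i.2⟩ : A))
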